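/- Let T : ℋⁿ → ℋⁿ be an ℝ-linear positive map and q ∈ (ℝⁿ₊)↓. Then the following are equivalent: (i) λ(|T(X)|) ≺_w q*λ(|X|) for all X ∈ ℋⁿ; (ii) λ(T(X)) ≺_w q*λ(X) for all positive semidefinite X ∈ ℋⁿ; (iii) λ(T(P)) ≺_w q*λ(P) for every nonzero projection P ∈ ℋⁿ; (iv) λ(T*(X)) ≺_w q*λ(X) for all positive semidefinite X ∈ ℋⁿ; (v) λ(T*(P)) ≺_w q*λ(P) for every nonzero projection P ∈ ℋⁿ. -/

import Mathlib

open Matrix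
open scoped ComplexOrder

/-- Sum of the `k` largest entries of `p` (as a supremum of sums over `k`-subsets). -/
noncomputable def sumLargest {n : ℕ} (p : Fin n → ℝ) (k : ℕ) : ℝ :=
  sSup ((fun A : Finset (Fin n) => ∑ i ∈ A, p i) '' {A : Finset (Fin n) | A.card = k})

/-- `p` is weakly majorized by `q`. -/
def WeakMaj {n : ℕ} (p q : Fin n → ℝ) : Prop :=
  ∀ k : ℕ, 1 ≤ k → k ≤ n → sumLargest p k ≤ sumLargest q k

/-- `p` is majorized by `q`. -/
def Maj {n : ℕ} (p q : Fin n → ℝ) : Prop :=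
  WeakMaj p q ∧ ∑ i, p i = ∑ i, q i

/-- `p` has nonnegative entries arranged in decreasing order. -/
def DecrNonneg {n : ℕ} (p : Fin n → ℝ) : Prop :=
  Antitone p ∧ ∀ i, 0 ≤ p i

/-- The decreasing rearrangement of a vector. -/
noncomputable def decrRearrange {n : ℕ} (p : Fin n → ℝ) : Fin n → ℝ :=
  fun i => p (Tuple.sort p (Fin.rev i))

/-- `x` is the supremum of `S` in the weak-majorization order (w-sup). -/
def IsWSup {n : ℕ} (S : Set (Fin n → ℝ)) (x : Fin n → ℝ) : Prop :=
  DecrNonneg x ∧ (∀ s ∈ S, WeakMaj s x) ∧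
    ∀ p : Fin n → ℝ, (∀ i, 0 ≤ p i) → (∀ s ∈ S, WeakMaj s p) → WeakMaj x p

/-- `x` is the infimum of `Q` in the weak-majorization order (w-inf). -/
def IsWInf {n : ℕ} (Q : Set (Fin n → ℝ)) (x : Fin n → ℝ) : Prop :=
  DecrNonneg x ∧ (∀ q ∈ Q, WeakMaj x q) ∧
    ∀ p : Fin n → ℝ, (∀ i, 0 ≤ p i) → (∀ q ∈ Q, WeakMaj p q) → WeakMaj p x

open Classical in
/-- The vector of eigenvalues of a Hermitian matrix, in decreasing order
(junk value `0` if the matrix is not Hermitian). -/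
noncomputable def specVec {n : ℕ} (X : Matrix (Fin n) (Fin n) ℂ) : Fin n → ℝ :=
  if h : X.IsHermitian then decrRearrange h.eigenvalues else 0

open Classical in
/-- `λ(|X|)`: the absolute values of the eigenvalues of a Hermitian matrix `X`,
in decreasing order. -/
noncomputable def absSpecVec {n : ℕ} (X : Matrix (Fin n) (Fin n) ℂ) : Fin n → ℝ :=
  if h : X.IsHermitian then decrRearrange (fun i => |h.eigenvalues i|) else 0

/-- The Jordan product `X ∘ Y = (XY + YX)/2`. -/
noncomputable def jmul {n : ℕ} (X Y : Matrix (Fin n) (Fin n) ℂ) : Matrix (Fin n) (Fin n) ℂ :=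
  (2 : ℂ)⁻¹ • (X * Y + Y * X)

/-- A nonzero (orthogonal) projection in `ℋⁿ`. -/
def IsProjection {n : ℕ} (P : Matrix (Fin n) (Fin n) ℂ) : Prop :=
  P.IsHermitian ∧ P * P = P ∧ P ≠ 0

/-- An involution in `ℋⁿ`: a Hermitian matrix with `ε² = I`. -/
def IsInvolution {n : ℕ} (ε : Matrix (Fin n) (Fin n) ℂ) : Prop :=
  ε.IsHermitian ∧ ε * ε = 1

/-- A positive map: maps positive semidefinite matrices to positive semidefinite matrices. -/
def PositiveMap {n : ℕ} (T : Matrix (Fin n) (Fin n) ℂ → Matrix (Fin n) (Fin n) ℂ) : Prop :=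
  ∀ X : Matrix (Fin n) (Fin n) ℂ, X.PosSemidef → (T X).PosSemidef

/-- `S` is the adjoint of `T` with respect to the trace inner product on `ℋⁿ`. -/
def IsAdjointOf {n : ℕ} (S T : Matrix (Fin n) (Fin n) ℂ → Matrix (Fin n) (Fin n) ℂ) : Prop :=
  ∀ X Y : Matrix (Fin n) (Fin n) ℂ, X.IsHermitian → Y.IsHermitian →
    Matrix.trace (T X * Y) = Matrix.trace (X * S Y)

/-- `q` is the least vector of `T`: `λ(|T(X)|) ≺_w q * λ(|X|)` for all Hermitian `X`,
and `q ≺_w q'` for any other `q' ∈ (ℝⁿ₊)↓` with the same property. -/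
def IsLeastVector {n : ℕ} (T : Matrix (Fin n) (Fin n) ℂ → Matrix (Fin n) (Fin n) ℂ)
    (q : Fin n → ℝ) : Prop :=
  DecrNonneg q ∧
  (∀ X : Matrix (Fin n) (Fin n) ℂ, X.IsHermitian →
    WeakMaj (absSpecVec (T X)) (q * absSpecVec X)) ∧
  ∀ q' : Fin n → ℝ, DecrNonneg q' →
    (∀ X : Matrix (Fin n) (Fin n) ℂ, X.IsHermitian →
      WeakMaj (absSpecVec (T X)) (q' * absSpecVec X)) → WeakMaj q q'

/-- The sum of the first `k` entries of `d`. -/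
def prefixSum {n : ℕ} (k : ℕ) (d : Fin n → ℝ) : ℝ := ∑ i, if i.val < k then d i else 0

/-- The indicator vector of the first `k` indices. -/
def initialVec (n k : ℕ) : Fin n → ℝ := fun i => if i.val < k then 1 else 0

/-- The Hermitian matrix `U diag(d) U*`. -/
noncomputable def conjDiagonal {n : ℕ} (U : Matrix (Fin n) (Fin n) ℂ) (d : Fin n → ℝ) :
    Matrix (Fin n) (Fin n) ℂ :=
  U * diagonal (fun i => (d i : ℂ)) * star U

lemma antitone_initialVec (n k : ℕ) : Antitone (initialVec n k) := by
  intro i j hij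
  have : i.val ≤ j.val := hij
  unfold initialVec
  split_ifs <;> first | omega | norm_num

lemma initialVec_nonneg (n k : ℕ) (i : Fin n) : 0 ≤ initialVec n k i := by
  unfold initialVec
  split_ifs <;> norm_num

lemma card_filter_val_lt {n k : ℕ} (hk : k ≤ n) :
    (Finset.univ.filter (fun i : Fin n => i.val < k)).card = k := by
  rw [Fin.card_filter_val_lt, min_eq_right hk]

lemma sum_mul_le_prefixSum {n k : ℕ} (hk : k ≤ n) {e t : Fin n → ℝ} (he : Antitone e)
    (ht0 : ∀ j, 0 ≤ t j) (ht1 : ∀ j, t j ≤ 1) (ht : ∑ j, t j = k) :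
    ∑ j, e j * t j ≤ prefixSum k e := by
  rcases Nat.eq_zero_or_pos n with rfl | hn
  · simp [prefixSum]
  set c := e ⟨k - 1, by omega⟩ with hc
  have key : ∑ j, (e j * t j - c * t j) ≤
      ∑ j : Fin n, ((if j.val < k then e j else 0) - c * (if j.val < k then 1 else 0)) := by
    refine Finset.sum_le_sum fun j _ => ?_
    split_ifs with h
    · have : c ≤ e j := he (Fin.mk_le_mk.2 (by omega) : j ≤ ⟨k - 1, by omega⟩)
      nlinarith [ht1 j]
    · have : e j ≤ c := he (Fin.mk_le_mk.2 (by omega) : ⟨k - 1, by omega⟩ ≤ j)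
      nlinarith [ht0 j]
  have hcard : ∑ j : Fin n, (if j.val < k then (1 : ℝ) else 0) = k := by
    rw [Finset.sum_boole, card_filter_val_lt hk]
  rw [Finset.sum_sub_distrib, Finset.sum_sub_distrib, ← Finset.mul_sum, ← Finset.mul_sum, ht,
    hcard] at key
  unfold prefixSum
  linarith

lemma sumLargest_of_antitone {n k : ℕ} (hk : k ≤ n) {e : Fin n → ℝ} (he : Antitone e) :
    sumLargest e k = prefixSum k e := by
  have hmem : prefixSum k e ∈ (fun A : Finset (Fin n) => ∑ i ∈ A, e i) ''
      {A : Finset (Fin n) | A.card = k} :=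
    ⟨_, card_filter_val_lt hk, by simp only [prefixSum, Finset.sum_filter]⟩
  refine IsGreatest.csSup_eq ⟨hmem, ?_⟩
  rintro _ ⟨A, hA, rfl⟩
  have h := sum_mul_le_prefixSum hk he (t := fun j => if j ∈ A then 1 else 0)
    (fun j => by split_ifs <;> norm_num)
    (fun j => by split_ifs <;> norm_num)
    (by simpa using hA)
  simpa using h

lemma prefixSum_succ {n : ℕ} (d : Fin n → ℝ) (i : Fin n) :
    prefixSum (i.val + 1) d = prefixSum i.val d + d i := by
  unfold prefixSum
  have : d i = ∑ j : Fin n, if j = i then d j else 0 := by simp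
  rw [this, ← Finset.sum_add_distrib]
  refine Finset.sum_congr rfl fun j _ => ?_
  rcases lt_trichotomy j i with h | h | h
  · have h' : j.val < i.val := h
    simp [h', h.ne, Nat.lt_succ_of_lt h']
  · simp [h]
  · have h' : i.val < j.val := h
    simp [h.ne', h'.not_gt, h'.not_ge]

lemma eq_of_prefixSum_eq {n : ℕ} {d e : Fin n → ℝ}
    (h : ∀ k ≤ n, prefixSum k d = prefixSum k e) : d = e := by
  funext i
  have h1 := h (i.val + 1) i.isLt
  rw [prefixSum_succ, prefixSum_succ, h i.val i.isLt.le] at h1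
  linarith

lemma antitone_decrRearrange {n : ℕ} (p : Fin n → ℝ) : Antitone (decrRearrange p) :=
  fun _ _ hij => Tuple.monotone_sort p (Fin.rev_le_rev.2 hij)

lemma exists_eq_sum_smul_initialVec {n : ℕ} {d : Fin n → ℝ} (hd : DecrNonneg d) :
    ∃ c : Fin n → ℝ, (∀ m, 0 ≤ c m) ∧ d = ∑ m, c m • initialVec n (m.val + 1) := by
  let d' : ℕ → ℝ := fun i => if h : i < n then d ⟨i, h⟩ else 0
  refine ⟨fun m => d' m - d' (m + 1), fun m => ?_, ?_⟩
  · simp only [d', m.isLt, dif_pos]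
    split_ifs with h
    · exact sub_nonneg.2 (hd.1 (Fin.mk_le_mk.2 (Nat.le_succ _)))
    · simpa using hd.2 m
  · funext i
    have hsum : ∑ m ∈ Finset.Ico i.val n, (d' m - d' (m + 1)) = d' i - d' n := by
      have := Finset.sum_Ico_sub d' i.isLt.le
      rw [← neg_inj, ← Finset.sum_neg_distrib]
      simpa using this
    have hr := Fin.sum_univ_eq_sum_range
      (fun m => (d' m - d' (m + 1)) * (if i.val < m + 1 then 1 else 0)) n
    simp only [Finset.sum_apply, Pi.smul_apply, initialVec, smul_eq_mul]
    rw [hr]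
    have : d i = d' i - d' n := by simp [d']
    rw [this, ← hsum]
    simp only [mul_ite, mul_one, mul_zero, ← Finset.sum_filter]
    refine Finset.sum_congr ?_ fun _ _ => rfl
    ext m
    simp only [Finset.mem_Ico, Finset.mem_filter, Finset.mem_range]
    omega

section Unitary

variable {n : ℕ} {U V W : Matrix (Fin n) (Fin n) ℂ}

lemma conjDiagonal_apply (U : Matrix (Fin n) (Fin n) ℂ) (d : Fin n → ℝ) (a b : Fin n) :
    conjDiagonal U d a b = ∑ j, U a j * (d j : ℂ) * star (U b j) := by
  rw [conjDiagonal, Matrix.mul_apply]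
  simp only [mul_diagonal, star_apply]

lemma isHermitian_conjDiagonal (U : Matrix (Fin n) (Fin n) ℂ) (d : Fin n → ℝ) :
    (conjDiagonal U d).IsHermitian := by
  unfold conjDiagonal
  refine isHermitian_mul_mul_conjTranspose U ?_
  rw [isHermitian_diagonal_iff]
  intro i
  simp [isSelfAdjoint_iff]

lemma posSemidef_conjDiagonal (U : Matrix (Fin n) (Fin n) ℂ) {d : Fin n → ℝ} (hd : ∀ i, 0 ≤ d i) :
    (conjDiagonal U d).PosSemidef := by
  unfold conjDiagonal
  refine PosSemidef.mul_mul_conjTranspose_same ?_ U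
  rw [posSemidef_diagonal_iff]
  intro i
  exact_mod_cast hd i

lemma conjDiagonal_sum_smul {ι : Type*} (s : Finset ι) (U : Matrix (Fin n) (Fin n) ℂ) (c : ι → ℝ)
    (d : ι → Fin n → ℝ) :
    conjDiagonal U (∑ m ∈ s, c m • d m) = ∑ m ∈ s, c m • conjDiagonal U (d m) := by
  ext a b
  simp only [conjDiagonal_apply, Matrix.sum_apply, Matrix.smul_apply, Finset.sum_apply,
    Pi.smul_apply, Finset.smul_sum]
  rw [Finset.sum_comm]
  refine Finset.sum_congr rfl fun j _ => ?_
  push_cast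
  rw [Finset.mul_sum, Finset.sum_mul]
  refine Finset.sum_congr rfl fun m _ => ?_
  simp only [smul_eq_mul, Complex.real_smul]
  push_cast
  ring

lemma conjDiagonal_add (U : Matrix (Fin n) (Fin n) ℂ) (d e : Fin n → ℝ) :
    conjDiagonal U (d + e) = conjDiagonal U d + conjDiagonal U e := by
  simp [conjDiagonal, ← diagonal_add, mul_add, add_mul]

lemma conjDiagonal_sub (U : Matrix (Fin n) (Fin n) ℂ) (d e : Fin n → ℝ) :
    conjDiagonal U (d - e) = conjDiagonal U d - conjDiagonal U e := by
  simp [conjDiagonal, ← diagonal_sub, mul_sub, sub_mul]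

lemma submatrix_perm_mem_unitaryGroup (hU : U ∈ unitaryGroup (Fin n) ℂ)
    (σ : Equiv.Perm (Fin n)) : U.submatrix id σ ∈ unitaryGroup (Fin n) ℂ := by
  rw [mem_unitaryGroup_iff'] at hU ⊢
  rw [star_eq_conjTranspose, conjTranspose_submatrix, ← submatrix_mul _ _ σ id σ Function.bijective_id,
    ← star_eq_conjTranspose, hU]
  simp

lemma conjDiagonal_comp_perm (U : Matrix (Fin n) (Fin n) ℂ) (d : Fin n → ℝ)
    (σ : Equiv.Perm (Fin n)) :
    conjDiagonal (U.submatrix id σ) (d ∘ σ) = conjDiagonal U d := by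
  ext a b
  simp only [conjDiagonal_apply, submatrix_apply, id, Function.comp]
  exact Equiv.sum_comp σ (fun j => U a j * (d j : ℂ) * star (U b j))

lemma star_mul_conjDiagonal_mul_self (hU : U ∈ unitaryGroup (Fin n) ℂ) (d : Fin n → ℝ) :
    star U * conjDiagonal U d * U = diagonal (fun i => (d i : ℂ)) := by
  have h := mem_unitaryGroup_iff'.1 hU
  unfold conjDiagonal
  calc _ = (star U * U) * diagonal (fun i => (d i : ℂ)) * (star U * U) := by
        simp only [Matrix.mul_assoc]
    _ = _ := by simp [h]

lemma eq_conjDiagonal_eigenvalues {X : Matrix (Fin n) (Fin n) ℂ} (h : X.IsHermitian) :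
    X = conjDiagonal (h.eigenvectorUnitary : Matrix (Fin n) (Fin n) ℂ) h.eigenvalues := by
  conv_lhs => rw [h.spectral_theorem]
  rfl

lemma exists_perm_decrRearrange (p : Fin n → ℝ) :
    ∃ σ : Equiv.Perm (Fin n), decrRearrange p = p ∘ σ :=
  ⟨Fin.revPerm.trans (Tuple.sort p), rfl⟩

lemma antitone_specVec (X : Matrix (Fin n) (Fin n) ℂ) : Antitone (specVec X) := by
  unfold specVec
  split_ifs
  · exact antitone_decrRearrange _
  · exact antitone_const

lemma antitone_absSpecVec (X : Matrix (Fin n) (Fin n) ℂ) : Antitone (absSpecVec X) := by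
  unfold absSpecVec
  split_ifs
  · exact antitone_decrRearrange _
  · exact antitone_const

lemma absSpecVec_nonneg (X : Matrix (Fin n) (Fin n) ℂ) (i : Fin n) : 0 ≤ absSpecVec X i := by
  unfold absSpecVec
  split_ifs
  · exact abs_nonneg _
  · exact le_rfl

lemma absSpecVec_eq_specVec {X : Matrix (Fin n) (Fin n) ℂ} (hX : X.PosSemidef) :
    absSpecVec X = specVec X := by
  have h : (fun i => |hX.1.eigenvalues i|) = hX.1.eigenvalues :=
    funext fun i => abs_of_nonneg (hX.eigenvalues_nonneg i)
  simp [absSpecVec, specVec, hX.1, h]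

lemma exists_eq_conjDiagonal_specVec {X : Matrix (Fin n) (Fin n) ℂ} (h : X.IsHermitian) :
    ∃ U ∈ unitaryGroup (Fin n) ℂ, X = conjDiagonal U (specVec X) := by
  obtain ⟨σ, hσ⟩ := exists_perm_decrRearrange h.eigenvalues
  refine ⟨_, submatrix_perm_mem_unitaryGroup h.eigenvectorUnitary.2 σ, ?_⟩
  rw [specVec, dif_pos h, hσ, conjDiagonal_comp_perm]
  exact eq_conjDiagonal_eigenvalues h

lemma exists_eq_conjDiagonal_absSpecVec {X : Matrix (Fin n) (Fin n) ℂ} (h : X.IsHermitian) :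
    ∃ U ∈ unitaryGroup (Fin n) ℂ, ∃ d : Fin n → ℝ,
      X = conjDiagonal U d ∧ absSpecVec X = fun i => |d i| := by
  obtain ⟨σ, hσ⟩ := exists_perm_decrRearrange (fun i => |h.eigenvalues i|)
  refine ⟨_, submatrix_perm_mem_unitaryGroup h.eigenvectorUnitary.2 σ, h.eigenvalues ∘ σ, ?_, ?_⟩
  · rw [conjDiagonal_comp_perm]
    exact eq_conjDiagonal_eigenvalues h
  · rw [absSpecVec, dif_pos h, hσ]
    rfl

lemma re_trace_mul_conjDiagonal (Y V : Matrix (Fin n) (Fin n) ℂ) (b : Fin n → ℝ) :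
    (trace (Y * conjDiagonal V b)).re = ∑ i, b i * ((star V * Y * V) i i).re := by
  have : trace (Y * conjDiagonal V b) =
      trace ((star V * Y * V) * diagonal (fun i => (b i : ℂ))) := by
    rw [conjDiagonal, ← Matrix.mul_assoc, trace_mul_comm]
    simp only [Matrix.mul_assoc]
  rw [this, trace, Complex.re_sum]
  refine Finset.sum_congr rfl fun i _ => ?_
  rw [diag_apply, mul_diagonal, Complex.re_mul_ofReal, mul_comm]

lemma re_trace_mul_conjDiagonal_initialVec (Y V : Matrix (Fin n) (Fin n) ℂ) (k : ℕ) :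
    (trace (Y * conjDiagonal V (initialVec n k))).re =
      prefixSum k (fun i => ((star V * Y * V) i i).re) := by
  simp [re_trace_mul_conjDiagonal, prefixSum, initialVec]

lemma re_trace_conjDiagonal_self (hU : U ∈ unitaryGroup (Fin n) ℂ) (d : Fin n → ℝ) (k : ℕ) :
    (trace (conjDiagonal U d * conjDiagonal U (initialVec n k))).re = prefixSum k d := by
  rw [re_trace_mul_conjDiagonal_initialVec, star_mul_conjDiagonal_mul_self hU]
  simp

lemma sum_normSq_row (hU : U ∈ unitaryGroup (Fin n) ℂ) (i : Fin n) :
    ∑ j, Complex.normSq (U i j) = 1 := by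
  have h := congrFun (congrFun (mem_unitaryGroup_iff.1 hU) i) i
  simp only [Matrix.mul_apply, star_apply, one_apply_eq, RCLike.star_def, Complex.mul_conj] at h
  exact_mod_cast h

lemma sum_normSq_col (hU : U ∈ unitaryGroup (Fin n) ℂ) (j : Fin n) :
    ∑ i, Complex.normSq (U i j) = 1 := by
  have h := congrFun (congrFun (mem_unitaryGroup_iff'.1 hU) j) j
  simp only [Matrix.mul_apply, star_apply, one_apply_eq, RCLike.star_def, mul_comm,
    Complex.mul_conj] at h
  exact_mod_cast h

/-- **Ky Fan's maximum principle**, upper bound. -/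
lemma re_trace_conjDiagonal_le_prefixSum (hU : U ∈ unitaryGroup (Fin n) ℂ)
    (hV : V ∈ unitaryGroup (Fin n) ℂ) {d : Fin n → ℝ} (hd : Antitone d) {k : ℕ} (hk : k ≤ n) :
    (trace (conjDiagonal U d * conjDiagonal V (initialVec n k))).re ≤ prefixSum k d := by
  set M := star U * V with hM
  have hMu : M ∈ unitaryGroup (Fin n) ℂ := mul_mem (Unitary.star_mem hU) hV
  have hdiag : ∀ i, ((star V * conjDiagonal U d * V) i i).re =
      ∑ j, d j * Complex.normSq (M j i) := by
    intro i
    have h1 : star V * conjDiagonal U d * V =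
        star M * (diagonal (fun i => (d i : ℂ)) * M) := by
      simp only [conjDiagonal, hM, star_mul, star_star, Matrix.mul_assoc]
    rw [h1, Matrix.mul_apply, Complex.re_sum]
    refine Finset.sum_congr rfl fun j _ => ?_
    rw [diagonal_mul, star_apply, RCLike.star_def, mul_left_comm, mul_comm (_ : ℂ) (M j i),
      Complex.mul_conj, ← Complex.ofReal_mul, Complex.ofReal_re]
  have hterm : ∀ j i : Fin n, 0 ≤ (if i.val < k then Complex.normSq (M j i) else 0) ∧
      (if i.val < k then Complex.normSq (M j i) else 0) ≤ Complex.normSq (M j i) := by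
    intro j i
    have := Complex.normSq_nonneg (M j i)
    split_ifs <;> simp [this]
  have key := sum_mul_le_prefixSum hk hd
    (t := fun j => ∑ i : Fin n, if i.val < k then Complex.normSq (M j i) else 0)
    (fun j => Finset.sum_nonneg fun i _ => (hterm j i).1)
    (fun j => (Finset.sum_le_sum fun i _ => (hterm j i).2).trans_eq (sum_normSq_row hMu j))
    (by
      rw [Finset.sum_comm]
      have : ∀ i : Fin n, (∑ j, if i.val < k then Complex.normSq (M j i) else 0) =
          if i.val < k then (1 : ℝ) else 0 := by
        intro i
        split_ifs
        · exact sum_normSq_col hMu i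
        · simp
      simp only [this]
      rw [Finset.sum_boole, card_filter_val_lt hk])
  refine le_of_eq_of_le ?_ key
  rw [re_trace_mul_conjDiagonal_initialVec, prefixSum]
  simp only [hdiag, Finset.mul_sum]
  rw [Finset.sum_comm]
  refine Finset.sum_congr rfl fun i _ => ?_
  split_ifs <;> simp

lemma specVec_conjDiagonal (hU : U ∈ unitaryGroup (Fin n) ℂ) {d : Fin n → ℝ} (hd : Antitone d) :
    specVec (conjDiagonal U d) = d := by
  obtain ⟨W, hW, h⟩ := exists_eq_conjDiagonal_specVec (isHermitian_conjDiagonal U d)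
  refine eq_of_prefixSum_eq fun k hk => le_antisymm ?_ ?_
  · rw [← re_trace_conjDiagonal_self hW, ← h]
    exact re_trace_conjDiagonal_le_prefixSum hU hW hd hk
  · rw [← re_trace_conjDiagonal_self hU]
    nth_rw 1 [h]
    exact re_trace_conjDiagonal_le_prefixSum hW hU (antitone_specVec _) hk

lemma isProjection_conjDiagonal (hU : U ∈ unitaryGroup (Fin n) ℂ) {m : ℕ} (hm : 1 ≤ m)
    (hmn : m ≤ n) : IsProjection (conjDiagonal U (initialVec n m)) := by
  have hUU := mem_unitaryGroup_iff'.1 hU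
  refine ⟨isHermitian_conjDiagonal _ _, ?_, fun h0 => ?_⟩
  · unfold conjDiagonal
    set E := diagonal (fun i => ((initialVec n m i : ℝ) : ℂ)) with hE
    have hEE : E * E = E := by
      rw [hE, diagonal_mul_diagonal]
      congr 1
      funext i
      unfold initialVec
      split_ifs <;> simp
    calc _ = U * (E * (star U * U) * E) * star U := by simp only [Matrix.mul_assoc]
      _ = _ := by rw [hUU, Matrix.mul_one, hEE]
  · have h := star_mul_conjDiagonal_mul_self hU (initialVec n m)
    rw [h0] at h
    have h' := congrFun (congrFun h ⟨0, by omega⟩) ⟨0, by omega⟩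
    have h1 : 0 < m := hm
    simp [initialVec, h1] at h'

end Unitary

lemma IsProjection.posSemidef {n : ℕ} {P : Matrix (Fin n) (Fin n) ℂ} (hP : IsProjection P) :
    P.PosSemidef := by
  have h := posSemidef_conjTranspose_mul_self P
  rwa [hP.1.eq, hP.2.1] at h

lemma specVec_nonneg {n : ℕ} {X : Matrix (Fin n) (Fin n) ℂ} (hX : X.PosSemidef) (i : Fin n) :
    0 ≤ specVec X i :=
  absSpecVec_eq_specVec hX ▸ absSpecVec_nonneg X i

lemma DecrNonneg.antitone_mul {n : ℕ} {q d : Fin n → ℝ} (hq : DecrNonneg q) (hd : DecrNonneg d) :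
    Antitone (q * d) :=
  fun i j hij => mul_le_mul (hq.1 hij) (hd.1 hij) (hd.2 j) (hq.2 i)

lemma weakMaj_iff_prefixSum_le {n : ℕ} {p q : Fin n → ℝ} (hp : Antitone p) (hq : Antitone q) :
    WeakMaj p q ↔ ∀ k : ℕ, 1 ≤ k → k ≤ n → prefixSum k p ≤ prefixSum k q := by
  refine forall₃_congr fun k _ hk => ?_
  rw [sumLargest_of_antitone hk hp, sumLargest_of_antitone hk hq]

/-- The pairings of `T P` with `Q`, for projections `P` and `Q` of ranks `m` and `k`, are bounded
by the sum of the first `min m k` entries of `q`. -/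
def ProjectionBound {n : ℕ} (T : Matrix (Fin n) (Fin n) ℂ → Matrix (Fin n) (Fin n) ℂ)
    (q : Fin n → ℝ) : Prop :=
  ∀ U ∈ unitaryGroup (Fin n) ℂ, ∀ V ∈ unitaryGroup (Fin n) ℂ, ∀ m k : ℕ,
    1 ≤ m → m ≤ n → 1 ≤ k → k ≤ n →
    (trace (T (conjDiagonal U (initialVec n m)) * conjDiagonal V (initialVec n k))).re ≤
      prefixSum k (q * initialVec n m)

lemma prefixSum_mul_initialVec_comm {n : ℕ} (q : Fin n → ℝ) (k m : ℕ) :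
    prefixSum k (q * initialVec n m) = prefixSum m (q * initialVec n k) := by
  refine Finset.sum_congr rfl fun i _ => ?_
  simp only [Pi.mul_apply, initialVec]
  split_ifs <;> simp

section PositiveMap

variable {n : ℕ} {T T' : Matrix (Fin n) (Fin n) ℂ → Matrix (Fin n) (Fin n) ℂ} {q : Fin n → ℝ}

lemma ProjectionBound.of_isAdjointOf (hadj : IsAdjointOf T' T) (h : ProjectionBound T q) :
    ProjectionBound T' q := by
  intro U hU V hV m k hm hmn hk hkn
  rw [prefixSum_mul_initialVec_comm, trace_mul_comm,
    ← hadj _ _ (isHermitian_conjDiagonal _ _) (isHermitian_conjDiagonal _ _)]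
  exact h V hV U hU k m hk hkn hm hmn

lemma IsAdjointOf.symm (hadj : IsAdjointOf T' T) : IsAdjointOf T T' := by
  intro X Y hX hY
  rw [trace_mul_comm, ← hadj Y X hY hX, trace_mul_comm]

lemma projectionBound_of_weakMaj (hT : ∀ X : Matrix (Fin n) (Fin n) ℂ, X.IsHermitian →
      (T X).IsHermitian) (hq : DecrNonneg q)
    (h : ∀ P : Matrix (Fin n) (Fin n) ℂ, IsProjection P →
      WeakMaj (specVec (T P)) (q * specVec P)) :
    ProjectionBound T q := by
  intro U hU V hV m k hm hmn hk hkn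
  have hP := h _ (isProjection_conjDiagonal hU hm hmn)
  rw [specVec_conjDiagonal hU (antitone_initialVec n m), weakMaj_iff_prefixSum_le
    (antitone_specVec _) (hq.antitone_mul ⟨antitone_initialVec n m, initialVec_nonneg n m⟩)] at hP
  obtain ⟨W, hW, hTW⟩ := exists_eq_conjDiagonal_specVec
    (hT _ (isHermitian_conjDiagonal U (initialVec n m)))
  rw [hTW]
  exact (re_trace_conjDiagonal_le_prefixSum hW hV (antitone_specVec _) hkn).trans (hP k hk hkn)

lemma ProjectionBound.re_trace_le (hTlin : IsLinearMap ℝ T) (h : ProjectionBound T q)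
    {U V : Matrix (Fin n) (Fin n) ℂ} (hU : U ∈ unitaryGroup (Fin n) ℂ)
    (hV : V ∈ unitaryGroup (Fin n) ℂ) {d : Fin n → ℝ} (hd : DecrNonneg d) {k : ℕ}
    (hk : 1 ≤ k) (hkn : k ≤ n) :
    (trace (T (conjDiagonal U d) * conjDiagonal V (initialVec n k))).re ≤
      prefixSum k (q * d) := by
  obtain ⟨c, hc, hdc⟩ := exists_eq_sum_smul_initialVec hd
  have hTd : T (conjDiagonal U d) =
      ∑ m : Fin n, c m • T (conjDiagonal U (initialVec n (m.val + 1))) := by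
    have := map_sum (IsLinearMap.mk' T hTlin)
      (fun m : Fin n => c m • conjDiagonal U (initialVec n (m.val + 1))) Finset.univ
    simp only [map_smul, IsLinearMap.mk'_apply] at this
    rw [← this, ← conjDiagonal_sum_smul, ← hdc]
  have hlhs : (trace (T (conjDiagonal U d) * conjDiagonal V (initialVec n k))).re =
      ∑ m : Fin n, c m * (trace (T (conjDiagonal U (initialVec n (m.val + 1))) *
        conjDiagonal V (initialVec n k))).re := by
    rw [hTd, Finset.sum_mul, trace_sum, Complex.re_sum]
    refine Finset.sum_congr rfl fun m _ => ?_
    rw [smul_mul_assoc, trace_smul, Complex.smul_re, smul_eq_mul]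
  have hrhs : prefixSum k (q * d) =
      ∑ m : Fin n, c m * prefixSum k (q * initialVec n (m.val + 1)) := by
    unfold prefixSum
    simp only [Finset.mul_sum]
    rw [Finset.sum_comm]
    refine Finset.sum_congr rfl fun i _ => ?_
    split_ifs
    · conv_lhs => rw [hdc]
      simp only [Pi.mul_apply, Finset.sum_apply, Pi.smul_apply, smul_eq_mul, Finset.mul_sum]
      exact Finset.sum_congr rfl fun m _ => by ring
    · simp
  rw [hlhs, hrhs]
  exact Finset.sum_le_sum fun m _ => mul_le_mul_of_nonneg_left
    (h U hU V hV _ k (Nat.succ_pos _) m.isLt hk hkn) (hc m)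

lemma ProjectionBound.weakMaj (hTlin : IsLinearMap ℝ T)
    (hT : ∀ X : Matrix (Fin n) (Fin n) ℂ, X.IsHermitian → (T X).IsHermitian)
    (hq : DecrNonneg q) (h : ProjectionBound T q) {X : Matrix (Fin n) (Fin n) ℂ}
    (hX : X.PosSemidef) : WeakMaj (specVec (T X)) (q * specVec X) := by
  have hd : DecrNonneg (specVec X) := ⟨antitone_specVec X, specVec_nonneg hX⟩
  rw [weakMaj_iff_prefixSum_le (antitone_specVec _) (hq.antitone_mul hd)]
  intro k hk hkn
  obtain ⟨U, hU, hXU⟩ := exists_eq_conjDiagonal_specVec hX.1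
  obtain ⟨W, hW, hTW⟩ := exists_eq_conjDiagonal_specVec (hT X hX.1)
  have := h.re_trace_le hTlin hU hW hd hk hkn
  rwa [← hXU, hTW, re_trace_conjDiagonal_self hW] at this

lemma ProjectionBound.weakMaj_abs (hTlin : IsLinearMap ℝ T) (hTpos : PositiveMap T)
    (hT : ∀ X : Matrix (Fin n) (Fin n) ℂ, X.IsHermitian → (T X).IsHermitian)
    (hq : DecrNonneg q) (h : ProjectionBound T q) {X : Matrix (Fin n) (Fin n) ℂ}
    (hX : X.IsHermitian) : WeakMaj (absSpecVec (T X)) (q * absSpecVec X) := by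
  have hd : DecrNonneg (absSpecVec X) := ⟨antitone_absSpecVec X, absSpecVec_nonneg X⟩
  rw [weakMaj_iff_prefixSum_le (antitone_absSpecVec _) (hq.antitone_mul hd)]
  intro k hk hkn
  obtain ⟨U, hU, d, hXU, hXd⟩ := exists_eq_conjDiagonal_absSpecVec hX
  obtain ⟨W, hW, e, hTW, hTe⟩ := exists_eq_conjDiagonal_absSpecVec (hT X hX)
  refine le_trans ?_ (h.re_trace_le hTlin hU hW hd hk hkn)
  set Y := conjDiagonal U (absSpecVec X) with hY
  have hadd : (T Y + T X).PosSemidef := by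
    rw [← hTlin.map_add, hY, hXd, hXU, ← conjDiagonal_add]
    exact hTpos _ (posSemidef_conjDiagonal U fun i => by
      rw [Pi.add_apply]
      linarith [neg_abs_le (d i)])
  have hsub : (T Y - T X).PosSemidef := by
    rw [← hTlin.map_sub, hY, hXd, hXU, ← conjDiagonal_sub]
    exact hTpos _ (posSemidef_conjDiagonal U fun i => by
      simpa using le_abs_self (d i))
  have hWX : ∀ i, ((star W * T X * W) i i).re = e i := by
    intro i
    rw [hTW, star_mul_conjDiagonal_mul_self hW]
    simp
  rw [re_trace_mul_conjDiagonal_initialVec]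
  refine Finset.sum_le_sum fun i _ => ?_
  split_ifs
  · have h1 := (Complex.nonneg_iff.1 ((hadd.conjTranspose_mul_mul_same W).diag_nonneg (i := i))).1
    have h2 := (Complex.nonneg_iff.1 ((hsub.conjTranspose_mul_mul_same W).diag_nonneg (i := i))).1
    rw [← star_eq_conjTranspose, mul_add, add_mul, Matrix.add_apply, Complex.add_re, hWX] at h1
    rw [← star_eq_conjTranspose, mul_sub, sub_mul, Matrix.sub_apply, Complex.sub_re, hWX] at h2
    rw [hTe]
    exact abs_le.2 ⟨by linarith, by linarith⟩
  · exact le_rfl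

end PositiveMap

theorem positive_map_weak_majorization_tfae (n : ℕ) (T T' : Matrix (Fin n) (Fin n) ℂ → Matrix (Fin n) (Fin n) ℂ)
    (hTlin : IsLinearMap ℝ T) (hT'lin : IsLinearMap ℝ T')
    (hTpos : PositiveMap T)
    (hT : ∀ X : Matrix (Fin n) (Fin n) ℂ, X.IsHermitian → (T X).IsHermitian)
    (hT' : ∀ X : Matrix (Fin n) (Fin n) ℂ, X.IsHermitian → (T' X).IsHermitian)
    (hadj : IsAdjointOf T' T)
    (q : Fin n → ℝ) (hq : DecrNonneg q) :
    List.TFAE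
      [∀ X : Matrix (Fin n) (Fin n) ℂ, X.IsHermitian → WeakMaj (absSpecVec (T X)) (q * absSpecVec X),
       ∀ X : Matrix (Fin n) (Fin n) ℂ, X.PosSemidef → WeakMaj (specVec (T X)) (q * specVec X),
       ∀ P : Matrix (Fin n) (Fin n) ℂ, IsProjection P → WeakMaj (specVec (T P)) (q * specVec P),
       ∀ X : Matrix (Fin n) (Fin n) ℂ, X.PosSemidef → WeakMaj (specVec (T' X)) (q * specVec X),
       ∀ P : Matrix (Fin n) (Fin n) ℂ, IsProjection P → WeakMaj (specVec (T' P)) (q * specVec P)] := by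
  tfae_have 1 → 2 := fun h X hX => by
    rw [← absSpecVec_eq_specVec (hTpos X hX), ← absSpecVec_eq_specVec hX]
    exact h X hX.1
  tfae_have 2 → 3 := fun h P hP => h P hP.posSemidef
  tfae_have 3 → 1 := fun h X hX =>
    (projectionBound_of_weakMaj hT hq h).weakMaj_abs hTlin hTpos hT hq hX
  tfae_have 3 → 4 := fun h X hX =>
    ((projectionBound_of_weakMaj hT hq h).of_isAdjointOf hadj).weakMaj hT'lin hT' hq hX
  tfae_have 4 → 5 := fun h P hP => h P hP.posSemidef
  tfae_have 5 → 2 := fun h X hX =>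
    ((projectionBound_of_weakMaj hT' hq h).of_isAdjointOf hadj.symm).weakMaj hTlin hT hq hX
  tfae_finish
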